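/- Specialize the staircase setting to a = n, b = 0 (so k = n, n ≥ 2). Then φ_1² does not divide Σ_{i=0}^{n} c_i · ((−1)^{n−1} det Ȳ · φ_{n+1})^i · φ_2^{n−i} in R; equivalently, the polynomial φ_1* determined by φ_1 · φ_1* = Σ_{i=0}^{n} c_i · ((−1)^{n−1} det Ȳ · φ_{n+1})^i · φ_2^{n−i} is not divisible by φ_1. -/

import Mathlib

open Matrix Finset

noncomputable section

/-- The determinant of the minor of the `ℕ`-indexed (0-based) matrix `Φ` on the 1-based
row/column range `[i, M]`; for `i = M + 1` this is the determinant of the empty matrix, `1`. -/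
def sminor {α : Type*} [CommRing α] (Φ : ℕ → ℕ → α) (i M : ℕ) : α :=
  (Matrix.of fun r c : Fin (M + 1 - i) => Φ (i - 1 + (r : ℕ)) (i - 1 + (c : ℕ))).det

/-- Package an `ℕ`-indexed (0-based) family of entries as an `n × n` matrix. -/
def toSq {α : Type*} (n : ℕ) (f : ℕ → ℕ → α) : Matrix (Fin n) (Fin n) α :=
  Matrix.of fun i j => f (i : ℕ) (j : ℕ)

/-- The core `Φ` of a staircase pair `(X, Y)` of `n × n` matrices with parameters
`a = k + b`; it is an `N × N` matrix, `N = (k-1)*n + b`, given here as a (0-based)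
`ℕ`-indexed family of entries.  For `1 ≤ j ≤ k-1` (1-based), the block rows
`(j-1)(n-1)+1 .. j(n-1)` carry `Y_{[2,n]}` in columns `(j-1)n+1 .. jn` and (for `j ≥ 2`)
`X_{[2,n]}` in columns `(j-2)n+1 .. (j-1)n`; the last `a - 1` rows carry `X_{[2,a]}` in
columns `(k-2)n+1 .. (k-1)n` and `Y_{[2,a]}^{[1,b]}` in columns `(k-1)n+1 .. N`. -/
def stairCore {α : Type*} [Zero α] (n k : ℕ) (Xf Yf : ℕ → ℕ → α) : ℕ → ℕ → α := fun r c =>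
  if r < (k - 1) * (n - 1) then
    if r / (n - 1) * n ≤ c ∧ c < r / (n - 1) * n + n then
      Yf (r % (n - 1) + 1) (c - r / (n - 1) * n)
    else if 1 ≤ r / (n - 1) ∧ (r / (n - 1) - 1) * n ≤ c ∧ c < r / (n - 1) * n then
      Xf (r % (n - 1) + 1) (c - (r / (n - 1) - 1) * n)
    else 0
  else
    if (k - 2) * n ≤ c ∧ c < (k - 1) * n then
      Xf (r - (k - 1) * (n - 1) + 1) (c - (k - 2) * n)
    else if (k - 1) * n ≤ c then
      Yf (r - (k - 1) * (n - 1) + 1) (c - (k - 1) * n)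
    else 0

/-- `det Ȳ`: determinant of the submatrix of `Y` on rows and columns `2..n` (1-based). -/
def detYbar {α : Type*} [CommRing α] (n : ℕ) (Yf : ℕ → ℕ → α) : α :=
  (Matrix.of fun i j : Fin (n - 1) => Yf ((i : ℕ) + 1) ((j : ℕ) + 1)).det

/-- Determinant of the minor of `Y` on rows `{1, 3, 4, …, n}` and columns `{2, …, n}`
(1-based). -/
def detYgamma {α : Type*} [CommRing α] (n : ℕ) (Yf : ℕ → ℕ → α) : α :=
  (Matrix.of fun i j : Fin (n - 1) =>
    Yf (if (i : ℕ) = 0 then 0 else (i : ℕ) + 1) ((j : ℕ) + 1)).det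

/-- `det (λ Y + μ X)` as a polynomial in the two variables `λ = X 0`, `μ = X 1`. -/
def detLM {α : Type*} [CommRing α] (n : ℕ) (Xf Yf : ℕ → ℕ → α) :
    MvPolynomial (Fin 2) α :=
  Matrix.det
    (((MvPolynomial.X 0 : MvPolynomial (Fin 2) α) • (toSq n Yf).map (fun p => MvPolynomial.C p)
      + (MvPolynomial.X 1 : MvPolynomial (Fin 2) α) • (toSq n Xf).map (fun p => MvPolynomial.C p)
      : Matrix (Fin n) (Fin n) (MvPolynomial (Fin 2) α)))

/-- The block `Y2`: submatrix of `Y` on rows `k+1 .. k+b` and columns `1 .. b` (1-based). -/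
def blockY2 (n k b : ℕ) (h : k + b ≤ n) (Y : Matrix (Fin n) (Fin n) ℂ) :
    Matrix (Fin b) (Fin b) ℂ :=
  Matrix.of fun i j => Y ⟨k + (i : ℕ), by have := i.isLt; omega⟩ (Fin.castLE (by omega) j)

/-- The `k × k` matrix `U = W11 - Y1 Y2⁻¹ W21` attached to a staircase pair `(X, Y)`,
where `[[W11, W12], [W21, W22]]` is the `a × a` leading block of `X Y⁻¹` (`W11` of size
`k × k`) and `[Y1; Y2]` is the submatrix of `Y` on rows `1..a`, columns `1..b`. -/
def blockU (n k b : ℕ) (h : k + b ≤ n) (X Y : Matrix (Fin n) (Fin n) ℂ) :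
    Matrix (Fin k) (Fin k) ℂ :=
  (Matrix.of fun i j : Fin k =>
      (X * Y⁻¹) (Fin.castLE (by omega) i) (Fin.castLE (by omega) j))
    - (Matrix.of fun (i : Fin k) (j : Fin b) =>
          Y (Fin.castLE (by omega) i) (Fin.castLE (by omega) j))
      * (blockY2 n k b h Y)⁻¹
      * (Matrix.of fun (i : Fin b) (j : Fin k) =>
          (X * Y⁻¹) ⟨k + (i : ℕ), by have := i.isLt; omega⟩ (Fin.castLE (by omega) j))

/-- The standard basis vector `e_{m+1}` (so `basisVec k 0 = e_1`, `basisVec k 1 = e_2`). -/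
def basisVec (k m : ℕ) : Fin k → ℂ := fun i => if (i : ℕ) = m then 1 else 0

/-- The vector `v_γ = U (e_2 + γ e_1)`, with `γ` the ratio of the minor of `Y` on rows
`{1,3,…,n}`, columns `{2,…,n}` by `det Ȳ`. -/
def vGamma (n k b : ℕ) (h : k + b ≤ n) (X Y : ℕ → ℕ → ℂ) : Fin k → ℂ :=
  (blockU n k b h (toSq n X) (toSq n Y)).mulVec
    (basisVec k 1 + (detYgamma n Y / detYbar n Y) • basisVec k 0)

/-- The coefficient ring for the generic staircase pair: polynomials over `ℂ` in the
variables `x_{ij}` (tagged `true`) and `y_{ij}` (tagged `false`). -/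
abbrev Rgen : Type := MvPolynomial (Bool × ℕ × ℕ) ℂ

/-- The generic staircase matrix `X` (0-based): `x_{ij}` for `i < a`, `b ≤ j < n`, else `0`. -/
def genX (n a b : ℕ) : ℕ → ℕ → Rgen := fun i j =>
  if i < a ∧ b ≤ j ∧ j < n then MvPolynomial.X (true, i, j) else 0

/-- The generic staircase matrix `Y` (0-based): `y_{ij}` except in the zero block
(`i ≥ a`, `j < b`). -/
def genY (n a b : ℕ) : ℕ → ℕ → Rgen := fun i j =>
  if i < n ∧ j < n ∧ ¬(a ≤ i ∧ j < b) then MvPolynomial.X (false, i, j) else 0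

/-- The coefficient ring for the generic band pair: polynomials over `ℂ` in variables
`a_{ij}`. -/
abbrev Rband : Type := MvPolynomial (ℕ × ℕ) ℂ

/-- The generic band entries `a_{ij}` (1-based). -/
def genA : ℕ → ℕ → Rband := fun i j => MvPolynomial.X (i, j)

/-- The band matrix `X` (0-based indices) built from the entries `a_{ij}` (1-based):
`X_{i, n-k+i-1+s} = a_{s,i}` for `1 ≤ i ≤ k`, `1 ≤ s ≤ k+1-i` (1-based). -/
def bandX {α : Type*} [Zero α] (n k : ℕ) (a : ℕ → ℕ → α) : ℕ → ℕ → α := fun i j =>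
  if i < k ∧ n - k + i ≤ j ∧ j < n then a (j + k + 1 - n - i) (i + 1) else 0

/-- The band matrix `Y` (0-based indices) built from the entries `a_{ij}` (1-based):
`Y_{ij} = a_{k+1-i+j, i}` for `max(1, i-k) ≤ j ≤ i` (1-based), `0` otherwise. -/
def bandY {α : Type*} [Zero α] (n k : ℕ) (a : ℕ → ℕ → α) : ℕ → ℕ → α := fun i j =>
  if j ≤ i ∧ i ≤ j + k ∧ i < n then a (k + 1 + j - i) (i + 1) else 0

/-- Top-left `k × k` block of `X * Y⁻¹`. -/
def bandUblock (n k : ℕ) (h : k ≤ n) (Xm Ym : Matrix (Fin n) (Fin n) ℂ) :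
    Matrix (Fin k) (Fin k) ℂ :=
  Matrix.of fun i j => (Xm * Ym⁻¹) (Fin.castLE h i) (Fin.castLE h j)

/-- `K(A;u) = [u, Au, …, A^{k-1}u]`. -/
def Kmat (k : ℕ) (A : Matrix (Fin k) (Fin k) ℂ) (u : Fin k → ℂ) :
    Matrix (Fin k) (Fin k) ℂ :=
  Matrix.of fun i j => (A ^ (j : ℕ)).mulVec u i

/-- `K1(A;u,v) = [v, u, Au, …, A^{k-2}u]`. -/
def K1mat (k : ℕ) (A : Matrix (Fin k) (Fin k) ℂ) (u v : Fin k → ℂ) :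
    Matrix (Fin k) (Fin k) ℂ :=
  Matrix.of fun i j => if (j : ℕ) = 0 then v i else (A ^ ((j : ℕ) - 1)).mulVec u i

/-- `K2(A;u,v) = [Av, u, Au, …, A^{k-2}u]`. -/
def K2mat (k : ℕ) (A : Matrix (Fin k) (Fin k) ℂ) (u v : Fin k → ℂ) :
    Matrix (Fin k) (Fin k) ℂ :=
  Matrix.of fun i j => if (j : ℕ) = 0 then A.mulVec v i else (A ^ ((j : ℕ) - 1)).mulVec u i

/-- `w`: the last row of the classical adjoint of `K1(A;u,v)`. -/
def wRow (k : ℕ) (A : Matrix (Fin k) (Fin k) ℂ) (u v : Fin k → ℂ) : Fin k → ℂ :=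
  fun j => (K1mat k A u v).adjugate ⟨k - 1, by have := j.isLt; omega⟩ j

/-- `K*(A;u,v)`: the matrix with rows `w, wA, …, wA^{k-1}`. -/
def Kstar (k : ℕ) (A : Matrix (Fin k) (Fin k) ℂ) (u v : Fin k → ℂ) :
    Matrix (Fin k) (Fin k) ℂ :=
  Matrix.of fun i j => Matrix.vecMul (wRow k A u v) (A ^ (i : ℕ)) j

/-- Extend a `k × k` matrix by zero to an `ℕ`-indexed family of entries. -/
def extMat {α : Type*} [Zero α] (k : ℕ) (M : Matrix (Fin k) (Fin k) α) : ℕ → ℕ → α :=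
  fun i j => if h : i < k ∧ j < k then M ⟨i, h.1⟩ ⟨j, h.2⟩ else 0

/-- A sparse specialization of `X`: row `1` is the last basis vector, row `i ≥ 2` is the basis
vector with index `i - 2`, and row `0` vanishes (all 0-based). -/
def sparseX {α : Type*} [CommRing α] (n : ℕ) : ℕ → ℕ → α := fun i j =>
  if (i = 1 ∧ j + 1 = n) ∨ (i = j + 2 ∧ i < n) then 1 else 0

/-- A sparse specialization of `Y`: a cyclic permutation matrix whose row `1` is scaled by `t`. -/
def sparseY {α : Type*} [CommRing α] (n : ℕ) (t : α) : ℕ → ℕ → α := fun i j =>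
  (if i = 1 then t else 1) * if (i = 0 ∧ j + 1 = n) ∨ (i = j + 1 ∧ i < n) then 1 else 0

/-- Evaluation of the generic entries at the sparse pair. -/
def sparseEval {α : Type*} [CommRing α] [Algebra ℂ α] (n : ℕ) (t : α) : Rgen →+* α :=
  (MvPolynomial.aeval fun p : Bool × ℕ × ℕ =>
    if p.1 then sparseX n p.2.1 p.2.2 else sparseY n t p.2.1 p.2.2).toRingHom

section Functoriality

variable {α β : Type*} [CommRing α] [CommRing β] (f : α →+* β)

theorem map_sminor (Φ : ℕ → ℕ → α) (i M : ℕ) :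
    f (sminor Φ i M) = sminor (fun r c => f (Φ r c)) i M := by
  simp only [sminor, RingHom.map_det]
  rfl

theorem map_detYbar (n : ℕ) (Y : ℕ → ℕ → α) :
    f (detYbar n Y) = detYbar n fun i j => f (Y i j) := by
  simp only [detYbar, RingHom.map_det]
  rfl

theorem map_det_toSq (n : ℕ) (Y : ℕ → ℕ → α) :
    f (toSq n Y).det = (toSq n fun i j => f (Y i j)).det := by
  simp only [RingHom.map_det]
  rfl

theorem map_stairCore (n k : ℕ) (X Y : ℕ → ℕ → α) :
    (fun r c => f (stairCore n k X Y r c)) =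
      stairCore n k (fun i j => f (X i j)) (fun i j => f (Y i j)) := by
  funext r c
  unfold stairCore
  split_ifs <;> simp

theorem map_sparseX (n : ℕ) : (fun i j => f (sparseX n i j)) = sparseX n := by
  funext i j
  unfold sparseX
  split_ifs <;> simp

theorem map_sparseY (n : ℕ) (t : α) : (fun i j => f (sparseY n t i j)) = sparseY n (f t) := by
  funext i j
  unfold sparseY
  split_ifs <;> simp

end Functoriality

section Specialization

variable {α : Type*} [CommRing α] [Algebra ℂ α]

theorem sparseEval_genX {n : ℕ} (hn : 2 ≤ n) (t : α) :
    (fun i j => sparseEval n t (genX n n 0 i j)) = sparseX n := by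
  funext i j
  by_cases h : i < n ∧ 0 ≤ j ∧ j < n
  · simp [genX, h, sparseEval]
  · have h' : ¬((i = 1 ∧ j + 1 = n) ∨ (i = j + 2 ∧ i < n)) := by omega
    rw [genX, if_neg h, sparseX, if_neg h', map_zero]

theorem sparseEval_genY {n : ℕ} (hn : 2 ≤ n) (t : α) :
    (fun i j => sparseEval n t (genY n n 0 i j)) = sparseY n t := by
  funext i j
  by_cases h : i < n ∧ j < n ∧ ¬(n ≤ i ∧ j < 0)
  · rw [genY, if_pos h]
    simp [sparseEval]
  · have h' : ¬((i = 0 ∧ j + 1 = n) ∨ (i = j + 1 ∧ i < n)) := by omega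
    rw [genY, if_neg h, sparseY, if_neg h', map_zero, mul_zero]

end Specialization

theorem detYbar_sparseY {α : Type*} [CommRing α] {n : ℕ} (hn : 2 ≤ n) (t : α) :
    detYbar n (sparseY n t) = 0 := by
  refine Matrix.det_eq_zero_of_row_eq_zero (⟨0, by omega⟩ : Fin (n - 1)) fun j => ?_
  have h' : ¬(((0 : ℕ) + 1 = 0 ∧ (j : ℕ) + 1 + 1 = n) ∨
      ((0 : ℕ) + 1 = (j : ℕ) + 1 + 1 ∧ 0 + 1 < n)) := by omega
  rw [Matrix.of_apply, sparseY, if_neg h', mul_zero]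

theorem det_sparseY {α : Type*} [CommRing α] {n : ℕ} (hn : 2 ≤ n) (t : α) :
    (toSq n (sparseY n t)).det = t * (toSq n (sparseY n (1 : α))).det := by
  have h : toSq n (sparseY n t) =
      Matrix.diagonal (fun i : Fin n => if i = ⟨1, by omega⟩ then t else 1) *
        toSq n (sparseY n (1 : α)) := by
    ext i j
    simp [toSq, sparseY, Matrix.diagonal_mul, Fin.ext_iff]
  rw [h, Matrix.det_mul, Matrix.det_diagonal, Finset.prod_ite_eq' Finset.univ]
  simp

theorem det_sparseY_one_ne_zero {K : Type*} [Field K] {n : ℕ} (hn : 2 ≤ n) :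
    (toSq n (sparseY n (1 : K))).det ≠ 0 := by
  intro h
  obtain ⟨v, hv, hv0⟩ := Matrix.exists_mulVec_eq_zero_iff.mpr h
  refine hv (funext fun j => ?_)
  have key : ∀ i : Fin n, (∀ c : Fin n,
      (((i : ℕ) = 0 ∧ (c : ℕ) + 1 = n) ∨ ((i : ℕ) = (c : ℕ) + 1 ∧ (i : ℕ) < n)) ↔ c = j) →
      v j = 0 := by
    intro i hi
    have := congrFun hv0 i
    simpa only [Matrix.mulVec, dotProduct, toSq, sparseY, Matrix.of_apply, hi, ite_self, one_mul,
      ite_mul, zero_mul, Finset.sum_ite_eq', Finset.mem_univ, if_true, Pi.zero_apply] using this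
  have hj := j.isLt
  by_cases hjn : (j : ℕ) + 1 < n
  · refine key ⟨j + 1, hjn⟩ fun c => ?_
    rw [Fin.ext_iff]
    dsimp only
    omega
  · refine key ⟨0, by omega⟩ fun c => ?_
    rw [Fin.ext_iff]
    dsimp only
    omega

theorem stairCore_zero_row {α : Type*} [CommRing α] {n : ℕ} (hn : 2 ≤ n) (c : ℕ) :
    stairCore n n (sparseX n) (sparseY n (0 : α)) 0 c = 0 := by
  have h0 : 0 < (n - 1) * (n - 1) := Nat.mul_pos (by omega) (by omega)
  simp [stairCore, h0, sparseY]

/-- The rows of the core of the sparse pair at `t = 0`, indexed by block `i` and position `s`. -/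
theorem stairCore_sparse {α : Type*} [CommRing α] {n i s c : ℕ} (hn : 2 ≤ n) (hi : i < n)
    (hs : s < n - 1) (hc : c < (n - 1) * n) :
    stairCore n n (sparseX n) (sparseY n (0 : α)) (i * (n - 1) + s) c =
      (if i < n - 1 ∧ 1 ≤ s ∧ c = i * n + s then 1 else 0) +
      (if 1 ≤ i ∧ c + n = i * n + (if s = 0 then n - 1 else s - 1) then 1 else 0) := by
  have hn1 : 0 < n - 1 := by omega
  have hdiv : (i * (n - 1) + s) / (n - 1) = i := by
    rw [mul_comm, Nat.mul_add_div hn1, Nat.div_eq_of_lt hs, add_zero]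
  have hmod : (i * (n - 1) + s) % (n - 1) = s := by
    rw [mul_comm, Nat.mul_add_mod, Nat.mod_eq_of_lt hs]
  have hpred : 1 ≤ i → (i - 1) * n + n = i * n := fun h => by
    rw [← Nat.succ_mul, Nat.succ_eq_add_one, Nat.sub_add_cancel h]
  unfold stairCore
  rw [hdiv, hmod]
  by_cases hin : i < n - 1
  · have hr : i * (n - 1) + s < (n - 1) * (n - 1) :=
      calc i * (n - 1) + s < i * (n - 1) + (n - 1) := by omega
        _ = (i + 1) * (n - 1) := (Nat.succ_mul _ _).symm
        _ ≤ (n - 1) * (n - 1) := Nat.mul_le_mul_right _ hin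
    rw [if_pos hr]
    unfold sparseX sparseY
    generalize i * n = q at *
    generalize (i - 1) * n = p at *
    split_ifs <;> first | omega | (simp only [false_and, false_or] at *; omega) | simp
  · obtain rfl : i = n - 1 := by omega
    have hr : (n - 1) * (n - 1) + s - (n - 1) * (n - 1) = s := by omega
    rw [if_neg (by omega), hr, show n - 2 = n - 1 - 1 by omega]
    have hp := hpred hn1
    unfold sparseX sparseY
    generalize (n - 1) * n = q at *
    generalize (n - 1 - 1) * n = p at *
    split_ifs <;> first | omega | simp

theorem sminor_sparse_one {α : Type*} [CommRing α] {n : ℕ} (hn : 2 ≤ n) :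
    sminor (stairCore n n (sparseX n) (sparseY n (0 : α))) 1 ((n - 1) * n) = 0 := by
  have h0 : 0 < (n - 1) * n := Nat.mul_pos (by omega) (by omega)
  refine Matrix.det_eq_zero_of_row_eq_zero
    (⟨0, by omega⟩ : Fin ((n - 1) * n + 1 - 1)) fun j => ?_
  simp [stairCore_zero_row hn]

theorem eq_zero_of_sparse_equations {α : Type*} [CommRing α] {n : ℕ} (hn : 2 ≤ n) (A : ℕ → ℕ → α)
    (hlast : ∀ j, j < n - 1 → A j (n - 1) = 0)
    (hcorner : A 0 0 = 0)
    (hfirst : ∀ s, 1 ≤ s → s < n - 1 → A 0 s = 0)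
    (hmid : ∀ j s, j + 1 < n - 1 → s + 1 < n - 1 → A (j + 1) (s + 1) + A j s = 0)
    (hend : ∀ s, s + 1 < n - 1 → A (n - 2) s = 0)
    {j k : ℕ} (hj : j < n - 1) (hk : k < n) : A j k = 0 := by
  have up : ∀ j k, j ≤ k → j < n - 1 → k < n - 1 → A j k = 0 := by
    intro j
    induction j with
    | zero =>
      intro k _ _ hk
      rcases Nat.eq_zero_or_pos k with rfl | h
      · exact hcorner
      · exact hfirst k h hk
    | succ j ih =>
      intro k hjk hj hk
      obtain ⟨k, rfl⟩ : ∃ l, k = l + 1 := ⟨k - 1, by omega⟩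
      have := hmid j k hj hk
      rwa [ih k (by omega) (by omega) (by omega), add_zero] at this
  have down : ∀ d j k, j + d = n - 2 → k < j → A j k = 0 := by
    intro d
    induction d with
    | zero =>
      intro j k hj hkj
      obtain rfl : j = n - 2 := hj
      exact hend k (by omega)
    | succ d ih =>
      intro j k hj hkj
      have := hmid j k (by omega) (by omega)
      rwa [ih (j + 1) (k + 1) (by omega) (by omega), zero_add] at this
  by_cases hkn : k = n - 1
  · exact hkn ▸ hlast j hj
  · rcases le_or_gt j k with h | h
    · exact up j k h hj (by omega)
    · exact down (n - 2 - j) j k (by omega) h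

theorem sminor_sparse_two_ne_zero {K : Type*} [Field K] {n : ℕ} (hn : 2 ≤ n) :
    sminor (stairCore n n (sparseX n) (sparseY n (0 : K))) 2 ((n - 1) * n) ≠ 0 := by
  intro h
  obtain ⟨N, hN⟩ : ∃ N, N = (n - 1) * n := ⟨_, rfl⟩
  rw [← hN] at h
  obtain ⟨w, hw, hw0⟩ := Matrix.exists_mulVec_eq_zero_iff.mpr h
  let W : ℕ → K := fun c => if hc : 1 ≤ c ∧ c < N then w ⟨c - 1, by omega⟩ else 0
  have hW0 : W 0 = 0 := by simp [W]
  have hNpos : 0 < N := hN ▸ Nat.mul_pos (by omega) (by omega)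
  have row : ∀ R, 1 ≤ R → R < N →
      ∑ c ∈ Finset.range N, stairCore n n (sparseX n) (sparseY n (0 : K)) R c * W c = 0 := by
    intro R hR hRN
    have h1 := congrFun hw0 (⟨R - 1, by omega⟩ : Fin (N + 1 - 2))
    simp only [Matrix.mulVec, dotProduct, Matrix.of_apply, Pi.zero_apply] at h1
    obtain ⟨M, hM⟩ : ∃ M, N = M + 1 := ⟨N - 1, by omega⟩
    rw [hM, Finset.sum_range_succ', hW0, mul_zero, add_zero,
      show M = N + 1 - 2 by omega, ← Fin.sum_univ_eq_sum_range
        (fun c => stairCore n n (sparseX n) (sparseY n (0 : K)) R (c + 1) * W (c + 1))]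
    refine Eq.trans (Finset.sum_congr rfl fun c _ => ?_) h1
    have hc := c.isLt
    have e1 : 2 - 1 + (R - 1) = R := by omega
    have e2 : 2 - 1 + (c : ℕ) = c + 1 := by omega
    have e3 : 1 ≤ (c : ℕ) + 1 ∧ (c : ℕ) + 1 < N := by omega
    rw [e1, e2]
    simp only [W, dif_pos e3, Nat.add_sub_cancel]
  have eqn : ∀ i s, i < n → s < n - 1 → 1 ≤ i * (n - 1) + s →
      (if i < n - 1 ∧ 1 ≤ s then W (i * n + s) else 0) +
        (if 1 ≤ i then W ((i - 1) * n + (if s = 0 then n - 1 else s - 1)) else 0) = 0 := by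
    intro i s hi hs hR
    have hRN : i * (n - 1) + s < N :=
      calc i * (n - 1) + s < i * (n - 1) + (n - 1) := by omega
        _ = (i + 1) * (n - 1) := (Nat.succ_mul _ _).symm
        _ ≤ n * (n - 1) := Nat.mul_le_mul_right _ hi
        _ = N := by rw [hN, mul_comm]
    have pick : ∀ a, a < N → ∑ c ∈ Finset.range N, (if c = a then (1 : K) else 0) * W c = W a := by
      intro a ha
      simp [ha]
    refine Eq.trans ?_ (row _ hR hRN)
    rw [Finset.sum_congr rfl fun c hc => by
      rw [stairCore_sparse hn hi hs (hN ▸ Finset.mem_range.mp hc), add_mul],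
      Finset.sum_add_distrib]
    congr 1
    · by_cases h1 : i < n - 1 ∧ 1 ≤ s
      · have hlt : i * n + s < N :=
          calc i * n + s < i * n + n := by omega
            _ = (i + 1) * n := (Nat.succ_mul _ _).symm
            _ ≤ (n - 1) * n := Nat.mul_le_mul_right _ h1.1
            _ = N := hN.symm
        rw [if_pos h1, ← pick _ hlt]
        simp only [h1.1, h1.2, true_and]
      · simp only [← and_assoc, h1, false_and, if_false, zero_mul, Finset.sum_const_zero]
    · by_cases h1 : 1 ≤ i
      · obtain ⟨i, rfl⟩ : ∃ l, i = l + 1 := ⟨i - 1, by omega⟩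
        obtain ⟨a, ha⟩ : ∃ a, a = if s = 0 then n - 1 else s - 1 := ⟨_, rfl⟩
        have han : a < n := by rw [ha]; split_ifs <;> omega
        have hlt : i * n + a < N :=
          calc i * n + a < i * n + n := by omega
            _ = (i + 1) * n := (Nat.succ_mul _ _).symm
            _ ≤ (n - 1) * n := Nat.mul_le_mul_right _ (by omega)
            _ = N := hN.symm
        rw [if_pos h1, ← ha, Nat.add_sub_cancel, ← pick _ hlt]
        refine Finset.sum_congr rfl fun c _ => ?_
        have hiff : (1 ≤ i + 1 ∧ c + n = (i + 1) * n + a) ↔ c = i * n + a := by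
          rw [Nat.succ_mul]
          omega
        simp only [hiff]
      · simp only [h1, false_and, if_false, zero_mul, Finset.sum_const_zero]
  have all : ∀ j k, j < n - 1 → k < n → W (j * n + k) = 0 := by
    intro j k hj hk
    refine eq_zero_of_sparse_equations hn (fun j k => W (j * n + k)) ?_ ?_ ?_ ?_ ?_ hj hk
    · intro j hj
      simpa using eqn (j + 1) 0 (by omega) (by omega) (by
        have : 0 < (j + 1) * (n - 1) := Nat.mul_pos (by omega) (by omega)
        omega)
    · simpa using hW0
    · intro s hs hs'
      have h1 : 0 < n - 1 := by omega
      simpa [hs, h1] using eqn 0 s (by omega) hs' (by omega)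
    · intro j s hj hs
      have h1 := eqn (j + 1) (s + 1) (by omega) hs (by omega)
      simpa [hj] using h1
    · intro s hs
      have h1 := eqn (n - 1) (s + 1) (by omega) hs (by omega)
      have h2 : 1 ≤ n - 1 := by omega
      simpa [h2, Nat.sub_sub] using h1
  refine hw (funext fun c => ?_)
  have hc := c.isLt
  have hcN : (c : ℕ) + 1 < N := by omega
  have h1 := all ((c + 1) / n) ((c + 1) % n) (Nat.div_lt_of_lt_mul (by rw [mul_comm]; omega))
    (Nat.mod_lt _ (by omega))
  rw [Nat.div_add_mod'] at h1
  simpa [W, hcN] using h1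

theorem coeff_zero_eq_det {α : Type*} [CommRing α] {n : ℕ} {X Y : ℕ → ℕ → α} {c : ℕ → α}
    (hc : detLM n X Y = ∑ i ∈ Finset.range (n + 1), MvPolynomial.C (c i)
      * (MvPolynomial.X 1 : MvPolynomial (Fin 2) α) ^ i
      * (MvPolynomial.X 0 : MvPolynomial (Fin 2) α) ^ (n - i)) :
    c 0 = (toSq n Y).det := by
  have h := congrArg (MvPolynomial.eval (fun i : Fin 2 => if i = 0 then (1 : α) else 0)) hc
  rw [detLM, RingHom.map_det, map_sum, Finset.sum_range_succ'] at h
  simp only [map_mul, map_pow, MvPolynomial.eval_C, MvPolynomial.eval_X] at h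
  simp only [one_ne_zero, if_false, if_true, one_pow, mul_one, pow_zero, ne_eq,
    Nat.succ_ne_zero, not_false_eq_true, zero_pow, mul_zero, Finset.sum_const_zero, zero_add] at h
  rw [← h]
  congr 1
  ext i j
  simp [toSq]

/-- for the pair of generic `n × n` matrices, `φ_1²` does not divide the
generalized exchange polynomial `Σ_{i=0}^{n} c_i ((-1)^(n-1) det Ȳ φ_{n+1})^i φ_2^(n-i)`. -/
theorem statement11 (n : ℕ) (hn : 2 ≤ n) (c : ℕ → Rgen)
    (hc : detLM n (genX n n 0) (genY n n 0)
        = ∑ i ∈ Finset.range (n + 1), MvPolynomial.C (c i)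
            * (MvPolynomial.X 1 : MvPolynomial (Fin 2) Rgen) ^ i
            * (MvPolynomial.X 0 : MvPolynomial (Fin 2) Rgen) ^ (n - i)) :
    ¬ ((sminor (stairCore n n (genX n n 0) (genY n n 0)) 1 ((n - 1) * n)) ^ 2 ∣
        ∑ i ∈ Finset.range (n + 1), c i
          * ((-1 : Rgen) ^ (n - 1) * detYbar n (genY n n 0)
              * sminor (stairCore n n (genX n n 0) (genY n n 0)) (n + 1) ((n - 1) * n)) ^ i
          * (sminor (stairCore n n (genX n n 0) (genY n n 0)) 2 ((n - 1) * n)) ^ (n - i)) := by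
  intro hdvd
  have h := map_dvd (sparseEval n (Polynomial.X : Polynomial ℂ)) hdvd
  simp only [map_sum, map_mul, map_pow, map_sminor, map_stairCore, map_detYbar,
    sparseEval_genX hn, sparseEval_genY hn, detYbar_sparseY hn] at h
  rw [Finset.sum_range_succ'] at h
  simp only [mul_zero, zero_mul, ne_eq, Nat.succ_ne_zero, not_false_eq_true, zero_pow,
    Finset.sum_const_zero, zero_add, pow_zero, mul_one, Nat.sub_zero] at h
  rw [coeff_zero_eq_det hc, map_det_toSq, sparseEval_genY hn, det_sparseY hn] at h
  have evalMinor : ∀ i, Polynomial.evalRingHom (0 : ℂ)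
      (sminor (stairCore n n (sparseX n) (sparseY n Polynomial.X)) i ((n - 1) * n)) =
      sminor (stairCore n n (sparseX n) (sparseY n 0)) i ((n - 1) * n) := by
    intro i
    rw [map_sminor, map_stairCore, map_sparseX, map_sparseY]
    simp
  have hX : (Polynomial.X : Polynomial ℂ) ∣
      sminor (stairCore n n (sparseX n) (sparseY n Polynomial.X)) 1 ((n - 1) * n) := by
    rw [Polynomial.X_dvd_iff, Polynomial.coeff_zero_eq_eval_zero]
    exact (evalMinor 1).trans (sminor_sparse_one hn)
  have h2 := (pow_dvd_pow_of_dvd hX 2).trans h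
  rw [sq, mul_assoc] at h2
  have h3 := (mul_dvd_mul_iff_left Polynomial.X_ne_zero).mp h2
  rw [Polynomial.X_dvd_iff, Polynomial.coeff_zero_eq_eval_zero, ← Polynomial.coe_evalRingHom,
    map_mul, map_pow, evalMinor, map_det_toSq, map_sparseY, map_one] at h3
  exact mul_ne_zero (det_sparseY_one_ne_zero hn) (pow_ne_zero _ (sminor_sparse_two_ne_zero hn)) h3

end
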